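/- The upper value function V⁺ of the game Γ_{Ẽ,δ} is a sub-solution on (s0,1)×Δ_δ(X×Z) of the Hamilton–Jacobi equation ω_t + ℋ⁺(t,μ,Dω) = 0, where ℋ⁺(t,μ,φ) = inf_{x∈Δ_δ(X)} sup_{z∈Δ_δ(Z)} (1/t)∫φ d(x⊗z − μ); that is, for every (t,μ) ∈ (s0,1)×Δ_δ(X×Z) and every (p,φ) ∈ D⁺V⁺(t,μ), one has p + ℋ⁺(t,μ,φ) ≥ 0. -/

import Mathlib

open MeasureTheory Set

noncomputable section

/-- Euclidean space `ℝ^n`. -/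
abbrev Euc (n : ℕ) := EuclideanSpace ℝ (Fin n)

/-- The squared Wasserstein distance
`W₂²(μ,ν) = inf_{γ ∈ Π(μ,ν)} ∫ ‖x−y‖² dγ(x,y)` (infimum over couplings). -/
def W2sq {Ω : Type*} [MeasurableSpace Ω] [NormedAddCommGroup Ω] (μ ν : Measure Ω) : ℝ :=
  sInf {c : ℝ | ∃ γ : Measure (Ω × Ω), IsProbabilityMeasure γ ∧
    γ.map Prod.fst = μ ∧ γ.map Prod.snd = ν ∧ c = ∫ p, ‖p.1 - p.2‖ ^ 2 ∂γ}

/-- The transform `φ*(x) = inf_{y ∈ K} ‖x − y‖² − φ(y)`. -/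
def cstar {Ω : Type*} [NormedAddCommGroup Ω] (K : Set Ω) (φ : Ω → ℝ) (x : Ω) : ℝ :=
  ⨅ y : K, (‖x - y.1‖ ^ 2 - φ y.1)

/-- The class `Ξ` of continuous functions `φ` on `K` with `φ(x*) = 0` and `φ = (φ*)*`. -/
def Xi {Ω : Type*} [NormedAddCommGroup Ω] (K : Set Ω) (xstar : Ω) : Set (Ω → ℝ) :=
  {φ | ContinuousOn φ K ∧ φ xstar = 0 ∧ ∀ x ∈ K, cstar K (cstar K φ) x = φ x}

/-- `φ` is a Kantorovich potential from `μ` to `ν`: `φ ∈ Ξ` and `∫φ dμ + ∫φ* dν = W₂²(μ,ν)`. -/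
def IsKantPotential {Ω : Type*} [MeasurableSpace Ω] [NormedAddCommGroup Ω]
    (K : Set Ω) (xstar : Ω) (μ ν : Measure Ω) (φ : Ω → ℝ) : Prop :=
  φ ∈ Xi K xstar ∧ (∫ x, φ x ∂μ) + (∫ x, cstar K φ x ∂ν) = W2sq μ ν

/-- The data of the sets `Δ_δ(X)`, `Δ_δ(Z)` and `Δ_δ(X×Z)`: convex compact sets of
probability measures with densities bounded below by a positive constant, `δ`-dense in
`Δ(X)` resp. `Δ(Z)`, and `Δ_δ(X×Z)` is the closed convex hull of the product measures. -/
structure DeltaSets (a b : ℕ) where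
  X : Set (Euc a)
  Z : Set (Euc b)
  hXc : IsCompact X
  hXconv : Convex ℝ X
  hXne : X.Nonempty
  hZc : IsCompact Z
  hZconv : Convex ℝ Z
  hZne : Z.Nonempty
  δ : ℝ
  hδ : 0 < δ
  DX : Set (Measure (Euc a))
  DZ : Set (Measure (Euc b))
  D : Set (Measure (Euc a × Euc b))
  hDXprob : ∀ μ ∈ DX, IsProbabilityMeasure μ
  hDXsupp : ∀ μ ∈ DX, μ Xᶜ = 0
  hDXconv : ∀ μ ∈ DX, ∀ ν ∈ DX, ∀ t ∈ Icc (0 : ℝ) 1,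
    ENNReal.ofReal t • μ + ENNReal.ofReal (1 - t) • ν ∈ DX
  hDXcomp : IsCompact {q : ProbabilityMeasure (Euc a) | (q : Measure (Euc a)) ∈ DX}
  hDXne : DX.Nonempty
  hDXdens : ∃ c : ENNReal, 0 < c ∧ ∀ μ ∈ DX, ∀ S : Set (Euc a), MeasurableSet S →
    c * volume (S ∩ X) ≤ μ S
  hDXapprox : ∀ μ : Measure (Euc a), IsProbabilityMeasure μ → μ Xᶜ = 0 →
    ∃ ν ∈ DX, W2sq ν μ ≤ δ ^ 2
  hDZprob : ∀ μ ∈ DZ, IsProbabilityMeasure μ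
  hDZsupp : ∀ μ ∈ DZ, μ Zᶜ = 0
  hDZconv : ∀ μ ∈ DZ, ∀ ν ∈ DZ, ∀ t ∈ Icc (0 : ℝ) 1,
    ENNReal.ofReal t • μ + ENNReal.ofReal (1 - t) • ν ∈ DZ
  hDZcomp : IsCompact {q : ProbabilityMeasure (Euc b) | (q : Measure (Euc b)) ∈ DZ}
  hDZne : DZ.Nonempty
  hDZdens : ∃ c : ENNReal, 0 < c ∧ ∀ μ ∈ DZ, ∀ S : Set (Euc b), MeasurableSet S →
    c * volume (S ∩ Z) ≤ μ S
  hDZapprox : ∀ μ : Measure (Euc b), IsProbabilityMeasure μ → μ Zᶜ = 0 →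
    ∃ ν ∈ DZ, W2sq ν μ ≤ δ ^ 2
  hDprob : ∀ θ ∈ D, IsProbabilityMeasure θ
  hDsupp : ∀ θ ∈ D, θ (X ×ˢ Z)ᶜ = 0
  hDconv : ∀ θ ∈ D, ∀ θ' ∈ D, ∀ t ∈ Icc (0 : ℝ) 1,
    ENNReal.ofReal t • θ + ENNReal.ofReal (1 - t) • θ' ∈ D
  hDcomp : IsCompact {q : ProbabilityMeasure (Euc a × Euc b) | (q : Measure (Euc a × Euc b)) ∈ D}
  hDprod : ∀ μ ∈ DX, ∀ ν ∈ DZ, μ.prod ν ∈ D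
  hDhull : ∀ C : Set (Measure (Euc a × Euc b)),
    (∀ μ ∈ DX, ∀ ν ∈ DZ, μ.prod ν ∈ C) →
    (∀ θ ∈ C, ∀ θ' ∈ C, ∀ t ∈ Icc (0 : ℝ) 1,
      ENNReal.ofReal t • θ + ENNReal.ofReal (1 - t) • θ' ∈ C) →
    IsClosed {q : ProbabilityMeasure (Euc a × Euc b) | (q : Measure (Euc a × Euc b)) ∈ C} →
    D ⊆ C

/-- Measurable measure-valued controls with values in `DD`. -/
def MControl {Ω : Type*} [MeasurableSpace Ω] (DD : Set (Measure Ω)) : Type _ :=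
  {x : ℝ → Measure Ω // Measurable x ∧ ∀ t, x t ∈ DD}

/-- `x` and `y` coincide almost everywhere on `[s0, t]`. -/
def AEEqOn {E : Type*} (s0 t : ℝ) (x y : ℝ → E) : Prop :=
  ∀ᵐ s ∂(volume.restrict (Icc s0 t)), x s = y s

/-- Nonanticipative with delay piecewise-constant (NADC) strategies for measure-valued
controls: the produced control is constant on each `[m/N,(m+1)/N)` and the strategy is
nonanticipative with delay `1/N`. -/
def IsNADCM {Ω₁ Ω₂ : Type*} [MeasurableSpace Ω₁] [MeasurableSpace Ω₂]
    {DZ : Set (Measure Ω₂)} {DX : Set (Measure Ω₁)}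
    (s0 : ℝ) (α : MControl DZ → MControl DX) : Prop :=
  ∃ N : ℕ, 0 < N ∧
    (∀ z : MControl DZ, ∀ k < N, ∃ c,
      ∀ s ∈ Ico ((k : ℝ) / N) ((k + 1 : ℝ) / N), (α z).1 s = c) ∧
    (∀ k < N, ∀ z z' : MControl DZ, AEEqOn s0 ((k : ℝ) / N) z.1 z'.1 →
      AEEqOn s0 ((k + 1 : ℝ) / N) (α z).1 (α z').1)

/-- The trajectory `θ(s) = (s0/s) θ0 + (1/s) ∫_{s0}^s x(t) ⊗ z(t) dt` in the space of
measures on `X × Z`. -/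
def mtraj {a b : ℕ} (s0 : ℝ) (θ0 : Measure (Euc a × Euc b))
    (x : ℝ → Measure (Euc a)) (z : ℝ → Measure (Euc b)) (s : ℝ) : Measure (Euc a × Euc b) :=
  ENNReal.ofReal (s0 / s) • θ0 +
    ENNReal.ofReal (1 / s) •
      Measure.bind (volume.restrict (Ioc s0 s)) (fun t => (x t).prod (z t))

/-- The squared Wasserstein distance from `θ` to the set `Et`:
`W₂²(θ,Ẽ) = inf_{q ∈ Ẽ} W₂²(θ,q)`. -/
def W2sqSet {Ω : Type*} [MeasurableSpace Ω] [NormedAddCommGroup Ω]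
    (θ : Measure Ω) (Et : Set (Measure Ω)) : ℝ :=
  ⨅ q : Et, W2sq θ q.1

/-- The upper value `V⁺(s0,θ0) = inf_α sup_z W₂²(θ^{s0,θ0,α(z),z}(1), Ẽ)`. -/
def WVplus {a b : ℕ} (DX : Set (Measure (Euc a))) (DZ : Set (Measure (Euc b)))
    (Et : Set (Measure (Euc a × Euc b))) (s0 : ℝ) (θ0 : Measure (Euc a × Euc b)) : ℝ :=
  ⨅ α : {α : MControl DZ → MControl DX // IsNADCM s0 α},
    ⨆ z : MControl DZ, W2sqSet (mtraj s0 θ0 (α.1 z).1 z.1 1) Et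

/-- The lower value `V⁻(s0,θ0) = sup_β inf_x W₂²(θ^{s0,θ0,x,β(x)}(1), Ẽ)`. -/
def WVminus {a b : ℕ} (DX : Set (Measure (Euc a))) (DZ : Set (Measure (Euc b)))
    (Et : Set (Measure (Euc a × Euc b))) (s0 : ℝ) (θ0 : Measure (Euc a × Euc b)) : ℝ :=
  ⨆ β : {β : MControl DX → MControl DZ // IsNADCM s0 β},
    ⨅ x : MControl DX, W2sqSet (mtraj s0 θ0 x.1 (β.1 x).1 1) Et

/-- The upper Hamiltonian `ℋ⁺(t,μ,φ) = inf_x sup_z (1/t) ∫ φ d(x⊗z − μ)`. -/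
def Hplus {a b : ℕ} (DX : Set (Measure (Euc a))) (DZ : Set (Measure (Euc b)))
    (t : ℝ) (μ : Measure (Euc a × Euc b)) (φ : Euc a × Euc b → ℝ) : ℝ :=
  ⨅ x : DX, ⨆ z : DZ, (1 / t) * ((∫ p, φ p ∂(x.1.prod z.1)) - ∫ p, φ p ∂μ)

/-- The lower Hamiltonian `ℋ⁻(t,μ,φ) = sup_z inf_x (1/t) ∫ φ d(x⊗z − μ)`. -/
def Hminus {a b : ℕ} (DX : Set (Measure (Euc a))) (DZ : Set (Measure (Euc b)))
    (t : ℝ) (μ : Measure (Euc a × Euc b)) (φ : Euc a × Euc b → ℝ) : ℝ :=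
  ⨆ z : DZ, ⨅ x : DX, (1 / t) * ((∫ p, φ p ∂(x.1.prod z.1)) - ∫ p, φ p ∂μ)

/-- `(p,φ)` belongs to the super-differential `D⁺ω(t̄,θ̄)`: the corresponding limsup as
`α → 0⁺`, `t → t̄`, uniformly over `θ ∈ D`, is nonpositive (ε–r formulation). -/
def InSuperDiff {Ω : Type*} [MeasurableSpace Ω] (s0 : ℝ) (D : Set (Measure Ω))
    (ω : ℝ → Measure Ω → ℝ) (tb : ℝ) (θb : Measure Ω) (p : ℝ) (φ : Ω → ℝ) : Prop :=
  ∀ ε > 0, ∃ r > 0, ∀ al ∈ Ioo (0 : ℝ) r, ∀ t ∈ Icc s0 1, |t - tb| < r → ∀ θ ∈ D,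
    ω t (ENNReal.ofReal (1 - al) • θb + ENNReal.ofReal al • θ) - ω tb θb
      - p * (t - tb) - al * ((∫ x, φ x ∂θ) - ∫ x, φ x ∂θb) ≤ ε * (al + |t - tb|)

/-- `(p,φ)` belongs to the sub-differential `D⁻ω(t̄,θ̄)`, i.e. `(−p,−φ) ∈ D⁺(−ω)(t̄,θ̄)`. -/
def InSubDiff {Ω : Type*} [MeasurableSpace Ω] (s0 : ℝ) (D : Set (Measure Ω))
    (ω : ℝ → Measure Ω → ℝ) (tb : ℝ) (θb : Measure Ω) (p : ℝ) (φ : Ω → ℝ) : Prop :=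
  InSuperDiff s0 D (fun t θ => -(ω t θ)) tb θb (-p) (fun x => -(φ x))

open ProbabilityTheory in
/-- Gluing. -/
lemma glue_coupling {Ω : Type*} [MeasurableSpace Ω] [NormedAddCommGroup Ω]
    [SecondCountableTopology Ω] [BorelSpace Ω] [StandardBorelSpace Ω]
    {m m' q : Measure Ω} (P γ : Measure (Ω × Ω)) [IsProbabilityMeasure P]
    [IsProbabilityMeasure γ] (hP1 : P.map Prod.fst = m) (hP2 : P.map Prod.snd = m')
    (hg1 : γ.map Prod.fst = m) (hg2 : γ.map Prod.snd = q) :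
    ∃ τ : Measure ((Ω × Ω) × Ω), IsProbabilityMeasure τ ∧ τ.map Prod.fst = γ ∧
      τ.map (fun w => (w.1.1, w.2)) = P := by
  have : Nonempty Ω := ⟨0⟩
  refine ⟨γ ⊗ₘ (P.condKernel.comap Prod.fst measurable_fst), inferInstance, ?_, ?_⟩
  · exact Measure.fst_compProd _ _
  · have hd : P.fst ⊗ₘ P.condKernel = P := P.disintegrate P.condKernel
    have hf : P.fst = γ.map Prod.fst := by rw [hg1, ← hP1]; rfl
    refine Eq.trans ?_ hd
    rw [hf]
    have h2 : Measurable (fun w : (Ω × Ω) × Ω => (w.1.1, w.2)) := by fun_prop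
    have : IsProbabilityMeasure (γ.map Prod.fst) := Measure.isProbabilityMeasure_map (by fun_prop)
    ext s hs
    rw [Measure.map_apply h2 hs, Measure.compProd_apply (h2 hs), Measure.compProd_apply hs,
      lintegral_map (Kernel.measurable_kernel_prodMk_left hs) measurable_fst]
    rfl

lemma pw1 {Ω : Type*} [NormedAddCommGroup Ω] {ε : ℝ} (hε : 0 < ε) (x y q : Ω) :
    ‖y - q‖ ^ 2 ≤ (1 + ε) * ‖x - q‖ ^ 2 + (1 + 1 / ε) * ‖x - y‖ ^ 2 := by
  have h : ‖y - q‖ ≤ ‖x - y‖ + ‖x - q‖ := by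
    have := norm_sub_le_norm_sub_add_norm_sub y x q
    rwa [norm_sub_rev y x] at this
  have h0 := norm_nonneg (y - q)
  have h1 : ‖y - q‖ ^ 2 ≤ (‖x - y‖ + ‖x - q‖) ^ 2 := by gcongr
  have h2 : 0 ≤ (ε * ‖x - q‖ - ‖x - y‖) ^ 2 / ε := by positivity
  have h3 : (ε * ‖x - q‖ - ‖x - y‖) ^ 2 / ε
      = ε * ‖x - q‖ ^ 2 - 2 * ‖x - q‖ * ‖x - y‖ + 1 / ε * ‖x - y‖ ^ 2 := by
    field_simp
    ring
  nlinarith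

lemma W2sq_nonneg {Ω : Type*} [MeasurableSpace Ω] [NormedAddCommGroup Ω] (μ ν : Measure Ω) :
    0 ≤ W2sq μ ν := by
  apply Real.sInf_nonneg
  rintro c ⟨γ, -, -, -, rfl⟩
  exact integral_nonneg fun p => by positivity

lemma W2sqSet_nonneg {Ω : Type*} [MeasurableSpace Ω] [NormedAddCommGroup Ω] (μ : Measure Ω)
    (Et : Set (Measure Ω)) : 0 ≤ W2sqSet μ Et :=
  Real.iInf_nonneg fun _ => W2sq_nonneg _ _

lemma W2sq_le_glue {Ω : Type*} [MeasurableSpace Ω] [NormedAddCommGroup Ω]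
    [SecondCountableTopology Ω] [BorelSpace Ω] [StandardBorelSpace Ω]
    {m m' q : Measure Ω} (P : Measure (Ω × Ω)) [IsProbabilityMeasure P]
    (hP1 : P.map Prod.fst = m) (hP2 : P.map Prod.snd = m') {ε : ℝ} (hε : 0 < ε)
    (hI : Integrable (fun w : Ω × Ω => ‖w.1 - w.2‖ ^ 2) P) :
    W2sq m' q ≤ (1 + ε) * W2sq m q + (1 + 1 / ε) * ∫ w, ‖w.1 - w.2‖ ^ 2 ∂P := by
  have hIn : 0 ≤ ∫ w, ‖w.1 - w.2‖ ^ 2 ∂P := integral_nonneg fun p => by positivity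
  have hm : IsProbabilityMeasure m := by
    rw [← hP1]; exact Measure.isProbabilityMeasure_map (by fun_prop)
  have hm' : IsProbabilityMeasure m' := by
    rw [← hP2]; exact Measure.isProbabilityMeasure_map (by fun_prop)
  by_cases hq : IsProbabilityMeasure q
  swap
  · have : W2sq m' q = 0 := by
      unfold W2sq
      convert Real.sInf_empty
      ext c
      simp only [mem_ofPred_eq, mem_empty_iff_false, iff_false]
      rintro ⟨γ, h1, h2, h3, h4⟩
      apply hq
      rw [← h3]; exact Measure.isProbabilityMeasure_map (by fun_prop)
    rw [this]
    have := W2sq_nonneg m q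
    positivity
  · have key : ∀ c ∈ {c : ℝ | ∃ γ : Measure (Ω × Ω), IsProbabilityMeasure γ ∧
        γ.map Prod.fst = m ∧ γ.map Prod.snd = q ∧ c = ∫ p, ‖p.1 - p.2‖ ^ 2 ∂γ},
        (W2sq m' q - (1 + 1 / ε) * ∫ w, ‖w.1 - w.2‖ ^ 2 ∂P) / (1 + ε) ≤ c := by
      rintro c ⟨γ, hγ, h1, h2, rfl⟩
      rw [div_le_iff₀ (by positivity), sub_le_iff_le_add, mul_comm _ (1 + ε)]
      obtain ⟨τ, hτ, ht1, ht2⟩ := glue_coupling P γ hP1 hP2 h1 h2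
      have mg : Measurable (fun w : (Ω × Ω) × Ω => (w.2, w.1.2)) := by fun_prop
      have mg2 : Measurable (fun w : (Ω × Ω) × Ω => (w.1.1, w.2)) := by fun_prop
      have mc : Continuous (fun w : Ω × Ω => ‖w.1 - w.2‖ ^ 2) := by fun_prop
      have hle : W2sq m' q ≤ ∫ w, ‖w.1 - w.2‖ ^ 2 ∂(τ.map (fun w : (Ω × Ω) × Ω => (w.2, w.1.2))) := by
        apply csInf_le
        · refine ⟨0, ?_⟩
          rintro c ⟨γ, -, -, -, rfl⟩
          exact integral_nonneg fun p => by positivity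
        · refine ⟨_, Measure.isProbabilityMeasure_map mg.aemeasurable, ?_, ?_, rfl⟩
          · rw [Measure.map_map measurable_fst mg, ← hP2, ← ht2,
              Measure.map_map measurable_snd mg2]
            rfl
          · rw [Measure.map_map measurable_snd mg, ← h2, ← ht1,
              Measure.map_map measurable_snd measurable_fst]
            rfl
      refine hle.trans ?_
      rw [integral_map mg.aemeasurable mc.aestronglyMeasurable]
      have e1 : ∫ p, ‖p.1 - p.2‖ ^ 2 ∂γ = ∫ w, ‖w.1.1 - w.1.2‖ ^ 2 ∂τ := by
        rw [← ht1, integral_map measurable_fst.aemeasurable mc.aestronglyMeasurable]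
      have e2 : ∫ p, ‖p.1 - p.2‖ ^ 2 ∂P = ∫ w, ‖w.1.1 - w.2‖ ^ 2 ∂τ := by
        rw [← ht2, integral_map mg2.aemeasurable mc.aestronglyMeasurable]
      have i2 : Integrable (fun w : (Ω × Ω) × Ω => ‖w.1.1 - w.2‖ ^ 2) τ := by
        rw [← ht2] at hI
        exact hI.comp_measurable mg2
      rw [e1, e2]
      by_cases i1 : Integrable (fun w : (Ω × Ω) × Ω => ‖w.1.1 - w.1.2‖ ^ 2) τ
      · rw [← integral_const_mul, ← integral_const_mul, ← integral_add (i1.const_mul _) (i2.const_mul _)]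
        apply integral_mono_of_nonneg (Filter.Eventually.of_forall fun w => by positivity)
          ((i1.const_mul _).add (i2.const_mul _))
        exact Filter.Eventually.of_forall fun w => pw1 hε _ _ _
      · rw [integral_undef i1, integral_undef]
        · rw [← e2]; positivity
        · intro i3
          apply i1
          refine Integrable.mono' ((i3.const_mul (1 + 1)).add (i2.const_mul (1 + 1 / 1))) ?_ ?_
          · apply Continuous.aestronglyMeasurable
            fun_prop
          · refine Filter.Eventually.of_forall fun w => ?_
            rw [Real.norm_of_nonneg (by positivity)]
            have := pw1 one_pos w.2 w.1.1 w.1.2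
            rw [norm_sub_rev w.2 w.1.1] at this
            exact this
    have hne : {c : ℝ | ∃ γ : Measure (Ω × Ω), IsProbabilityMeasure γ ∧
        γ.map Prod.fst = m ∧ γ.map Prod.snd = q ∧ c = ∫ p, ‖p.1 - p.2‖ ^ 2 ∂γ}.Nonempty := by
      refine ⟨_, m.prod q, inferInstance, ?_, ?_, rfl⟩
      · exact Measure.map_fst_prod.trans (by simp)
      · exact Measure.map_snd_prod.trans (by simp)
    have := le_csInf hne key
    rw [div_le_iff₀ (by positivity), sub_le_iff_le_add] at this
    rw [mul_comm (1 + ε)]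
    exact this

lemma W2sqSet_le_glue {Ω : Type*} [MeasurableSpace Ω] [NormedAddCommGroup Ω]
    [SecondCountableTopology Ω] [BorelSpace Ω] [StandardBorelSpace Ω]
    {m m' : Measure Ω} (Et : Set (Measure Ω)) (P : Measure (Ω × Ω)) [IsProbabilityMeasure P]
    (hP1 : P.map Prod.fst = m) (hP2 : P.map Prod.snd = m') {ε : ℝ} (hε : 0 < ε)
    (hI : Integrable (fun w : Ω × Ω => ‖w.1 - w.2‖ ^ 2) P) :
    W2sqSet m' Et ≤ (1 + ε) * W2sqSet m Et + (1 + 1 / ε) * ∫ w, ‖w.1 - w.2‖ ^ 2 ∂P := by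
  have hIn : 0 ≤ ∫ w, ‖w.1 - w.2‖ ^ 2 ∂P := integral_nonneg fun p => by positivity
  rcases isEmpty_or_nonempty Et with h | h
  · have h0 : W2sqSet m' Et = 0 := Real.iInf_of_isEmpty _
    have := W2sqSet_nonneg m Et
    rw [h0]
    positivity
  · have : (W2sqSet m' Et - (1 + 1 / ε) * ∫ w, ‖w.1 - w.2‖ ^ 2 ∂P) / (1 + ε) ≤ W2sqSet m Et := by
      apply le_ciInf
      intro q
      rw [div_le_iff₀ (by positivity), sub_le_iff_le_add, mul_comm]
      refine le_trans (ciInf_le ⟨0, ?_⟩ q) (W2sq_le_glue P hP1 hP2 hε hI)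
      rintro _ ⟨q, rfl⟩
      exact W2sq_nonneg _ _
    rw [div_le_iff₀ (by positivity), sub_le_iff_le_add, mul_comm] at this
    exact this

lemma coupling_abs {Ω ι : Type*} [MeasurableSpace Ω] [Fintype ι]
    (A A' : ι → Measure Ω) [∀ j, IsFiniteMeasure (A j)] [∀ j, IsFiniteMeasure (A' j)]
    (v w w' : ι → ENNReal) (θ θ' : Measure Ω) [IsProbabilityMeasure θ] [IsProbabilityMeasure θ']
    (hθ : θ = ∑ j, w j • A j) (hθ' : θ' = ∑ j, w' j • A' j)
    (hA : ∀ j, w j ≠ 0 → A j univ = 1) (hA' : ∀ j, w' j ≠ 0 → A' j univ = 1)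
    (hv : ∀ j, v j ≤ w j) (hv' : ∀ j, v j ≤ w' j) 
    (f : Ω × Ω → ENNReal) (hf : Measurable f) (r R l : ENNReal)
    (hr : ∀ j, ∫⁻ p, f p ∂((A j).prod (A' j)) ≤ r)
    (hR : ∀ i j, ∫⁻ p, f p ∂((A i).prod (A' j)) ≤ R)
    (hl : 1 ≤ ∑ j, v j + l) :
    ∃ π : Measure (Ω × Ω), IsProbabilityMeasure π ∧ π.map Prod.fst = θ ∧ π.map Prod.snd = θ' ∧
      ∫⁻ p, f p ∂π ≤ r + l * R := by
  set ρ : Measure Ω := ∑ j, (w j - v j) • A j with hρ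
  set ρ' : Measure Ω := ∑ j, (w' j - v j) • A' j with hρ'
  have e1 : θ = ∑ j, v j • A j + ρ := by
    rw [hθ, hρ, ← Finset.sum_add_distrib]
    refine Finset.sum_congr rfl fun j _ => ?_
    rw [← add_smul, add_tsub_cancel_of_le (hv j)]
  have e1' : θ' = ∑ j, v j • A' j + ρ' := by
    rw [hθ', hρ', ← Finset.sum_add_distrib]
    refine Finset.sum_congr rfl fun j _ => ?_
    rw [← add_smul, add_tsub_cancel_of_le (hv' j)]
  have u (j) : v j * A j univ = v j := by
    by_cases h : w j = 0
    · have : v j = 0 := le_antisymm (h ▸ hv j) bot_le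
      simp [this]
    · rw [hA j h, mul_one]
  have u' (j) : v j * A' j univ = v j := by
    by_cases h : w' j = 0
    · have : v j = 0 := le_antisymm (h ▸ hv' j) bot_le
      simp [this]
    · rw [hA' j h, mul_one]
  have s1 : 1 = ∑ j, v j + ρ univ := by
    have : θ univ = 1 := measure_univ
    rw [e1] at this
    simp [u] at this
    exact this.symm
  have s1' : 1 = ∑ j, v j + ρ' univ := by
    have : θ' univ = 1 := measure_univ
    rw [e1'] at this
    simp [u'] at this
    exact this.symm
  have vt : ∑ j, v j ≠ ⊤ := ne_top_of_le_ne_top ENNReal.one_ne_top (s1 ▸ le_self_add)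
  have hll : ρ univ ≤ l := by
    rw [s1] at hl
    exact (ENNReal.add_le_add_iff_left vt).1 hl
  have huu : ρ univ = ρ' univ := by
    have := s1.symm.trans s1'
    exact (ENNReal.add_right_inj vt).1 this
  have rt : ρ univ ≠ ⊤ := ne_top_of_le_ne_top ENNReal.one_ne_top (s1 ▸ le_add_self)
  have : IsFiniteMeasure ρ := ⟨lt_top_iff_ne_top.2 rt⟩
  have : IsFiniteMeasure ρ' := ⟨lt_top_iff_ne_top.2 (huu ▸ rt)⟩
  have q1 : ((ρ univ)⁻¹ * ρ univ) • ρ = ρ := by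
    by_cases h : ρ univ = 0
    · rw [Measure.measure_univ_eq_zero.1 h]; simp
    · rw [ENNReal.inv_mul_cancel h rt, one_smul]
  have q2 : ((ρ univ)⁻¹ * ρ univ) • ρ' = ρ' := by
    by_cases h : ρ univ = 0
    · rw [huu] at h
      rw [Measure.measure_univ_eq_zero.1 h]; simp
    · rw [ENNReal.inv_mul_cancel h rt, one_smul]
  set π : Measure (Ω × Ω) := ∑ j, v j • (A j).prod (A' j) + (ρ univ)⁻¹ • ρ.prod ρ' with hπ
  have m1 : π.map Prod.fst = θ := by
    rw [hπ, e1, Measure.map_add _ _ measurable_fst, ← Measure.mapₗ_apply_of_measurable measurable_fst,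
      map_sum]
    simp only [Measure.mapₗ_apply_of_measurable measurable_fst, Measure.map_smul,
      Measure.map_fst_prod, smul_smul, u', ← huu, q1]
  have m2 : π.map Prod.snd = θ' := by
    rw [hπ, e1', Measure.map_add _ _ measurable_snd, ← Measure.mapₗ_apply_of_measurable measurable_snd,
      map_sum]
    simp only [Measure.mapₗ_apply_of_measurable measurable_snd, Measure.map_smul,
      Measure.map_snd_prod, smul_smul, u, q2]
  refine ⟨π, ?_, m1, m2, ?_⟩
  · constructor
    have : θ univ = 1 := measure_univ
    rwa [← m1, Measure.map_apply measurable_fst MeasurableSet.univ] at this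
  · rw [hπ, lintegral_add_measure, lintegral_finsetSum_measure]
    simp only [lintegral_smul_measure, smul_eq_mul]
    refine add_le_add ?_ ?_
    · calc ∑ j, v j * ∫⁻ p, f p ∂((A j).prod (A' j)) ≤ ∑ j, v j * r := by
            gcongr with j; exact hr j
        _ = (∑ j, v j) * r := by rw [Finset.sum_mul]
        _ ≤ 1 * r := by gcongr; rw [s1]; exact le_self_add
        _ = r := one_mul r
    · have t1 : (∑ j, (w j - v j)) = ρ univ := by
        simp only [hρ, Measure.coe_finsetSum, Measure.coe_smul, Finset.sum_apply, Pi.smul_apply, smul_eq_mul]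
        refine Finset.sum_congr rfl fun j _ => ?_
        by_cases h : w j = 0
        · simp [h]
        · rw [hA j h, mul_one]
      have t1' : (∑ j, (w' j - v j)) = ρ univ := by
        rw [huu]
        simp only [hρ', Measure.coe_finsetSum, Measure.coe_smul, Finset.sum_apply, Pi.smul_apply, smul_eq_mul]
        refine Finset.sum_congr rfl fun j _ => ?_
        by_cases h : w' j = 0
        · simp [h]
        · rw [hA' j h, mul_one]
      have t2 : ∫⁻ p, f p ∂(ρ.prod ρ') ≤ ρ univ * ρ univ * R := by
        rw [lintegral_prod _ hf.aemeasurable]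
        have : ∀ i, ∫⁻ x, ∫⁻ y, f (x, y) ∂ρ' ∂(A i) ≤ ρ univ * R := by
          intro i
          have e : ∀ x, ∫⁻ y, f (x, y) ∂ρ' = ∑ j, (w' j - v j) * ∫⁻ y, f (x, y) ∂(A' j) := by
            intro x
            rw [hρ', lintegral_finsetSum_measure]
            simp only [lintegral_smul_measure, smul_eq_mul]
          simp_rw [e]
          rw [lintegral_finsetSum]
          · rw [← t1', Finset.sum_mul]
            gcongr with j
            rw [lintegral_const_mul _ hf.lintegral_prod_right']
            gcongr
            rw [← lintegral_prod _ hf.aemeasurable]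
            exact hR i j
          · intro j _
            exact hf.lintegral_prod_right'.const_mul _
        rw [hρ, lintegral_finsetSum_measure]
        simp only [lintegral_smul_measure, smul_eq_mul]
        calc _ ≤ ∑ i, (w i - v i) * (ρ univ * R) := by
              gcongr with i; exact this i
          _ = _ := by rw [← Finset.sum_mul, t1, mul_assoc]
      calc (ρ univ)⁻¹ * ∫⁻ p, f p ∂(ρ.prod ρ') ≤ (ρ univ)⁻¹ * (ρ univ * ρ univ * R) := by gcongr
        _ = ((ρ univ)⁻¹ * ρ univ) * (ρ univ * R) := by ring
        _ ≤ 1 * (l * R) := by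
            gcongr
            exact ENNReal.inv_mul_le_one _
        _ = l * R := one_mul _

lemma exists_partition {Ω : Type*} [MeasurableSpace Ω] [NormedAddCommGroup Ω] [BorelSpace Ω]
    {K : Set Ω} (hK : IsCompact K) {r : ℝ} (hr : 0 < r) :
    ∃ (n : ℕ) (C : Fin n → Set Ω), (∀ j, MeasurableSet (C j)) ∧ Pairwise (fun i j => Disjoint (C i) (C j)) ∧
      (⋃ j, C j) = K ∧ ∀ j, ∀ x ∈ C j, ∀ y ∈ C j, ‖x - y‖ ≤ r := by
  obtain ⟨t, -, htf, hcov⟩ := hK.finite_cover_balls (e := r / 2) (by positivity)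
  obtain ⟨n, e, -, rfl⟩ := htf.fin_param
  refine ⟨n, fun j => (K ∩ Metric.ball (e j) (r / 2)) \ ⋃ i : Fin n, ⋃ _ : i < j, Metric.ball (e i) (r / 2),
    fun j => ?_, ?_, ?_, ?_⟩
  · exact (hK.measurableSet.inter measurableSet_ball).diff
      (MeasurableSet.iUnion fun i => MeasurableSet.iUnion fun _ => measurableSet_ball)
  · have key : ∀ i j : Fin n, i < j → Disjoint
        ((K ∩ Metric.ball (e i) (r / 2)) \ ⋃ k : Fin n, ⋃ _ : k < i, Metric.ball (e k) (r / 2))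
        ((K ∩ Metric.ball (e j) (r / 2)) \ ⋃ k : Fin n, ⋃ _ : k < j, Metric.ball (e k) (r / 2)) := by
      intro i j hij
      rw [Set.disjoint_left]
      rintro x ⟨⟨_, h1⟩, _⟩ ⟨_, h2⟩
      exact h2 (mem_iUnion₂.2 ⟨i, hij, h1⟩)
    intro i j hij
    rcases lt_or_gt_of_ne hij with h | h
    · exact key i j h
    · exact (key j i h).symm
  · apply Subset.antisymm
    · exact iUnion_subset fun j x hx => hx.1.1
    · intro x hx
      have h1 := hcov hx
      simp only [mem_range, iUnion_exists, iUnion_iUnion_eq', mem_iUnion] at h1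
      obtain ⟨j, hj, hmin⟩ := (wellFounded_lt (α := Fin n)).has_min
        {j | x ∈ Metric.ball (e j) (r / 2)} h1
      refine mem_iUnion.2 ⟨j, ⟨hx, hj⟩, ?_⟩
      intro hc
      obtain ⟨i, hi, hxi⟩ := mem_iUnion₂.1 hc
      exact hmin i hxi hi
  · rintro j x ⟨⟨_, hx⟩, _⟩ y ⟨⟨_, hy⟩, _⟩
    rw [← dist_eq_norm]
    have := dist_triangle_right x y (e j)
    rw [Metric.mem_ball] at hx hy
    linarith

lemma cond_decomp {Ω : Type*} [MeasurableSpace Ω] {n : ℕ} (C : Fin n → Set Ω)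
    (hC : ∀ j, MeasurableSet (C j)) (hd : Pairwise (fun i j => Disjoint (C i) (C j)))
    (θ : Measure Ω) [IsProbabilityMeasure θ] (h0 : θ (⋃ j, C j)ᶜ = 0) :
    θ = ∑ j, θ (C j) • ProbabilityTheory.cond θ (C j) := by
  have h1 : θ.restrict (⋃ j, C j) = θ := Measure.restrict_eq_self_of_ae_mem (by
    rw [ae_iff]; exact h0)
  rw [Measure.restrict_iUnion hd hC, Measure.sum_fintype] at h1
  refine h1.symm.trans (Finset.sum_congr rfl fun j _ => ?_)
  unfold ProbabilityTheory.cond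
  rw [smul_smul]
  by_cases h : θ (C j) = 0
  · rw [Measure.restrict_eq_zero.2 h]; simp
  · rw [ENNReal.mul_inv_cancel h (measure_ne_top _ _), one_smul]

lemma lint_prod_le {Ω : Type*} [MeasurableSpace Ω] (A A' : Measure Ω) [IsFiniteMeasure A]
    [IsFiniteMeasure A'] (hA : A univ ≤ 1) (hA' : A' univ ≤ 1) (S T : Set Ω)
    (hS : ∀ᵐ x ∂A, x ∈ S) (hT : ∀ᵐ x ∂A', x ∈ T) (f : Ω × Ω → ENNReal) (hf : Measurable f)
    (c : ENNReal) (hc : ∀ x ∈ S, ∀ y ∈ T, f (x, y) ≤ c) : ∫⁻ p, f p ∂(A.prod A') ≤ c := by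
  rw [lintegral_prod _ hf.aemeasurable]
  calc _ ≤ ∫⁻ x, c * A' univ ∂A := by
        apply lintegral_mono_ae
        filter_upwards [hS] with x hx
        rw [← lintegral_const]
        apply lintegral_mono_ae
        filter_upwards [hT] with y hy using hc x hx y hy
    _ = c * A' univ * A univ := lintegral_const _
    _ ≤ c * 1 * 1 := by gcongr
    _ = c := by simp

lemma exists_class {Ω : Type*} [MeasurableSpace Ω] [NormedAddCommGroup Ω] [BorelSpace Ω]
    [SecondCountableTopology Ω] {K : Set Ω} (hK : IsCompact K) {c : ℝ} (hc : 0 < c) :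
    ∃ (I : Type) (_ : Finite I) (cl : Measure Ω → I), ∀ θ θ' : Measure Ω,
      IsProbabilityMeasure θ → IsProbabilityMeasure θ' → θ Kᶜ = 0 → θ' Kᶜ = 0 → cl θ = cl θ' →
      ∃ π : Measure (Ω × Ω), IsProbabilityMeasure π ∧ π.map Prod.fst = θ ∧ π.map Prod.snd = θ' ∧
        ∫⁻ p, ENNReal.ofReal (‖p.1 - p.2‖ ^ 2) ∂π ≤ ENNReal.ofReal c := by
  obtain ⟨n, C, hCm, hCd, hCK, hCr⟩ := exists_partition hK (r := √(c / 2)) (by positivity)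
  obtain ⟨B, hB⟩ := hK.isBounded.exists_norm_le
  obtain ⟨M, hM⟩ := exists_nat_gt (n * (2 * B) ^ 2 / (c / 2))
  have hM0 : (0 : ℝ) < M := lt_of_le_of_lt (by positivity) hM
  refine ⟨Fin n → Fin (M + 1), inferInstance, fun θ j => ⟨min ⌊M * (θ (C j)).toReal⌋₊ M, by omega⟩, ?_⟩
  intro θ θ' hθ hθ' h0 h0' hcl
  set v : Fin n → ℝ := fun j => (⌊M * (θ (C j)).toReal⌋₊ : ℝ) / M with hv
  have fl : ∀ (θ : Measure Ω), IsProbabilityMeasure θ → ∀ j, ⌊M * (θ (C j)).toReal⌋₊ ≤ M := by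
    intro θ hθ j
    apply Nat.floor_le_of_le
    have : (θ (C j)).toReal ≤ 1 := by
      apply ENNReal.toReal_le_of_le_ofReal zero_le_one
      simpa using prob_le_one
    nlinarith
  have hfe : ∀ j, ⌊M * (θ (C j)).toReal⌋₊ = ⌊M * (θ' (C j)).toReal⌋₊ := by
    intro j
    have := congrArg Fin.val (congrFun hcl j)
    simp only [min_eq_left (fl θ hθ j), min_eq_left (fl θ' hθ' j)] at this
    exact this
  have v1 : ∀ j, ENNReal.ofReal (v j) ≤ θ (C j) := by
    intro j
    apply ENNReal.ofReal_le_of_le_toReal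
    rw [hv, div_le_iff₀ hM0, mul_comm]
    exact Nat.floor_le (by positivity)
  have v1' : ∀ j, ENNReal.ofReal (v j) ≤ θ' (C j) := by
    intro j
    apply ENNReal.ofReal_le_of_le_toReal
    simp only [hv]
    rw [hfe, div_le_iff₀ hM0, mul_comm]
    exact Nat.floor_le (by positivity)
  have v2 : ∀ j, θ (C j) ≤ ENNReal.ofReal (v j) + ENNReal.ofReal (1 / M) := by
    intro j
    rw [← ENNReal.ofReal_add (by positivity) (by positivity),
      ENNReal.le_ofReal_iff_toReal_le (measure_ne_top _ _) (by positivity), hv, ← add_div,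
      le_div_iff₀ hM0, mul_comm]
    exact (Nat.lt_floor_add_one _).le
  have hl : 1 ≤ ∑ j, ENNReal.ofReal (v j) + ENNReal.ofReal (n * (1 / M)) := by
    calc (1 : ENNReal) = θ (⋃ j, C j) := by
          rw [hCK]
          exact ((prob_compl_eq_zero_iff hK.measurableSet).1 h0).symm
      _ ≤ ∑ j, θ (C j) := by
          exact measure_iUnion_fintype_le _ _
      _ ≤ ∑ j, (ENNReal.ofReal (v j) + ENNReal.ofReal (1 / M)) := by gcongr with j; exact v2 j
      _ = _ := by
          rw [Finset.sum_add_distrib]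
          congr 1
          rw [ENNReal.ofReal_mul (by positivity)]
          simp
  have hfm : Measurable (fun p : Ω × Ω => ENNReal.ofReal (‖p.1 - p.2‖ ^ 2)) := by fun_prop
  have cle : ∀ (θ : Measure Ω) (S : Set Ω), ProbabilityTheory.cond θ S univ ≤ 1 := by
    intro θ S
    unfold ProbabilityTheory.cond
    simp [ENNReal.inv_mul_le_one]
  have caeK : ∀ (θ : Measure Ω) j, ∀ᵐ x ∂ProbabilityTheory.cond θ (C j), x ∈ C j := by
    intro θ j
    exact ProbabilityTheory.ae_cond_mem (hCm j)
  obtain ⟨π, p1, p2, p3, p4⟩ := coupling_abs (fun j => ProbabilityTheory.cond θ (C j))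
    (fun j => ProbabilityTheory.cond θ' (C j)) (fun j => ENNReal.ofReal (v j))
    (fun j => θ (C j)) (fun j => θ' (C j)) θ θ'
    (cond_decomp C hCm hCd θ (by rwa [hCK])) (cond_decomp C hCm hCd θ' (by rwa [hCK]))
    (fun j hj => (ProbabilityTheory.cond_isProbabilityMeasure hj).measure_univ)
    (fun j hj => (ProbabilityTheory.cond_isProbabilityMeasure hj).measure_univ)
    v1 v1' _ hfm (ENNReal.ofReal (c / 2)) (ENNReal.ofReal ((2 * B) ^ 2)) _
    (fun j => lint_prod_le _ _ (cle _ _) (cle _ _) _ _ (caeK _ j) (caeK _ j) _ hfm _ (by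
      intro x hx y hy
      apply ENNReal.ofReal_le_ofReal
      have := hCr j x hx y hy
      calc ‖x - y‖ ^ 2 ≤ √(c / 2) ^ 2 := by gcongr
        _ = c / 2 := Real.sq_sqrt (by positivity)))
    (fun i j => lint_prod_le _ _ (cle _ _) (cle _ _) _ _ (caeK _ i) (caeK _ j) _ hfm _ (by
      intro x hx y hy
      apply ENNReal.ofReal_le_ofReal
      have hx' : x ∈ K := hCK ▸ mem_iUnion.2 ⟨i, hx⟩
      have hy' : y ∈ K := hCK ▸ mem_iUnion.2 ⟨j, hy⟩
      have : ‖x - y‖ ≤ 2 * B := by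
        have := norm_sub_le x y
        linarith [hB x hx', hB y hy']
      show ‖x - y‖ ^ 2 ≤ _
      gcongr)) hl
  refine ⟨π, p1, p2, p3, p4.trans ?_⟩
  rw [← ENNReal.ofReal_mul (by positivity), ← ENNReal.ofReal_add (by positivity) (by positivity)]
  apply ENNReal.ofReal_le_ofReal
  have h5 : (n : ℝ) * (1 / M) * (2 * B) ^ 2 ≤ c / 2 := by
    rw [div_lt_iff₀ (by positivity)] at hM
    rw [mul_one_div, div_mul_eq_mul_div, div_le_iff₀ hM0]
    linarith
  linarith

open ProbabilityTheory in
lemma barycenter_mem {Ω : Type*} [MeasurableSpace Ω] [TopologicalSpace Ω] [HasOuterApproxClosed Ω]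
    [BorelSpace Ω]
    (DD : Set (Measure Ω)) (hprob : ∀ μ ∈ DD, IsProbabilityMeasure μ)
    (hconv : ∀ μ ∈ DD, ∀ ν ∈ DD, ∀ t ∈ Icc (0 : ℝ) 1,
      ENNReal.ofReal t • μ + ENNReal.ofReal (1 - t) • ν ∈ DD)
    (hcomp : IsCompact {q : ProbabilityMeasure Ω | (q : Measure Ω) ∈ DD})
    (z : ℝ → Measure Ω) (hz : Measurable z) (hzD : ∀ t, z t ∈ DD)
    (P : Measure ℝ) [IsProbabilityMeasure P] : P.bind z ∈ DD := by
  let κ : Kernel ℝ Ω := ⟨z, hz⟩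
  have hκ : IsMarkovKernel κ := ⟨fun t => hprob _ (hzD t)⟩
  have hb : P.bind z = P.bind κ := rfl
  have hbp : IsProbabilityMeasure (P.bind κ) := by infer_instance
  have hint : ∀ f : BoundedContinuousFunction Ω ℝ,
      ∫ x, f x ∂(P.bind κ) = ∫ t, ∫ x, f x ∂(z t) ∂P := fun f =>
    by
    exact Kernel.integral_comp (κ := Kernel.const Unit P) (η := κ) (a := ()) (f.integrable _)
  have hintg : ∀ f : BoundedContinuousFunction Ω ℝ, Integrable (fun t => ∫ x, f x ∂(z t)) P := by
    intro f
    exact Integrable.integral_comp (κ := Kernel.const Unit P) (η := κ) (a := ()) (by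
      exact f.integrable _)
  have key : ({q : ProbabilityMeasure Ω | (q : Measure Ω) ∈ DD} ∩
      ⋂ f : BoundedContinuousFunction Ω ℝ,
        {q : ProbabilityMeasure Ω | ∫ x, f x ∂(q : Measure Ω) = ∫ x, f x ∂(P.bind κ)}).Nonempty := by
    apply hcomp.inter_iInter_nonempty
    · intro f
      exact isClosed_eq (ProbabilityMeasure.continuous_integral_boundedContinuousFunction f)
        continuous_const
    · intro u
      let Lm : ProbabilityMeasure Ω → (u → ℝ) := fun q f => ∫ x, f.1 x ∂(q : Measure Ω)
      have hL : Continuous Lm := continuous_pi fun f =>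
        ProbabilityMeasure.continuous_integral_boundedContinuousFunction f.1
      have hcl : IsClosed (Lm '' {q : ProbabilityMeasure Ω | (q : Measure Ω) ∈ DD}) :=
        (hcomp.image hL).isClosed
      have hcv : Convex ℝ (Lm '' {q : ProbabilityMeasure Ω | (q : Measure Ω) ∈ DD}) := by
        rintro _ ⟨q, hq, rfl⟩ _ ⟨q', hq', rfl⟩ s t hs ht hst
        have hm := hconv _ hq _ hq' s ⟨hs, by linarith⟩
        have ht' : 1 - s = t := by linarith
        rw [ht'] at hm
        refine ⟨⟨_, hprob _ hm⟩, hm, ?_⟩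
        funext f
        simp only [Lm, ProbabilityMeasure.coe_mk, Pi.add_apply, Pi.smul_apply, smul_eq_mul]
        rw [integral_add_measure ((f.1.integrable _).smul_measure ENNReal.ofReal_ne_top)
          ((f.1.integrable _).smul_measure ENNReal.ofReal_ne_top), integral_smul_measure,
          integral_smul_measure, ENNReal.toReal_ofReal hs, ENNReal.toReal_ofReal ht]
        rfl
      have hmem := hcv.integral_mem hcl (μ := P) (f := fun t => Lm ⟨z t, hprob _ (hzD t)⟩)
        (Filter.Eventually.of_forall fun t => ⟨_, hzD t, rfl⟩)
        (Integrable.of_eval fun f => hintg f.1)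
      obtain ⟨q, hq, hqe⟩ := hmem
      refine ⟨q, hq, ?_⟩
      simp only [mem_iInter]
      intro f hf
      have := congrFun hqe ⟨f, hf⟩
      rw [eval_integral (f := fun t => Lm ⟨z t, hprob _ (hzD t)⟩) (fun f => hintg f.1)] at this
      show _ = _
      rw [hint]
      exact this
  obtain ⟨q, hq, hqe⟩ := key
  simp only [mem_iInter] at hqe
  have : (q : Measure Ω) = P.bind κ := ext_of_forall_integral_eq_of_IsFiniteMeasure fun f => hqe f
  rw [hb, ← this]
  exact hq

open ProbabilityTheory in
lemma measurable_prodM {Ω₁ Ω₂ : Type*} [MeasurableSpace Ω₁] [MeasurableSpace Ω₂]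
    (x : ℝ → Measure Ω₁) (z : ℝ → Measure Ω₂) (hx : Measurable x) (hz : Measurable z)
    (hxp : ∀ t, IsProbabilityMeasure (x t)) (hzp : ∀ t, IsProbabilityMeasure (z t)) :
    Measurable (fun t => (x t).prod (z t)) := by
  let κ : Kernel ℝ Ω₁ := ⟨x, hx⟩
  let η : Kernel ℝ Ω₂ := ⟨z, hz⟩
  have hκ : IsMarkovKernel κ := ⟨hxp⟩
  have hη : IsMarkovKernel η := ⟨hzp⟩
  have : (fun t => (x t).prod (z t)) = fun t => (κ ×ₖ η) t := by
    funext t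
    rw [Kernel.prod_apply]
    rfl
  rw [this]
  exact Kernel.measurable _

lemma bind_prod_const {Ω₁ Ω₂ : Type*} [MeasurableSpace Ω₁] [MeasurableSpace Ω₂]
    (x : Measure Ω₁) (z : ℝ → Measure Ω₂) (hz : Measurable z)
    [IsProbabilityMeasure x] (hzp : ∀ t, IsProbabilityMeasure (z t)) (P : Measure ℝ)
    [SFinite (P.bind z)] :
    P.bind (fun t => x.prod (z t)) = x.prod (P.bind z) := by
  have hm := measurable_prodM (fun _ => x) z measurable_const hz (fun _ => inferInstance) hzp
  ext s hs
  rw [Measure.bind_apply hs hm.aemeasurable, Measure.prod_apply_symm hs,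
    Measure.lintegral_bind hz.aemeasurable (measurable_measure_prodMk_right hs).aemeasurable]
  refine lintegral_congr fun t => ?_
  have := hzp t
  rw [Measure.prod_apply_symm hs]

/-- the averaged control -/
def zavg {Ω : Type*} [MeasurableSpace Ω] (t t' : ℝ) (z : ℝ → Measure Ω) : Measure Ω :=
  (ENNReal.ofReal (1 / (t' - t)) • volume.restrict (Ioc t t')).bind z

/-- position at time `t'` -/
def Tht {a b : ℕ} (t t' : ℝ) (μ : Measure (Euc a × Euc b)) (x0 : Measure (Euc a))
    (ζ : Measure (Euc b)) : Measure (Euc a × Euc b) :=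
  ENNReal.ofReal (1 - (t' - t) / t') • μ + ENNReal.ofReal ((t' - t) / t') • x0.prod ζ

lemma isProb_unif {t t' : ℝ} (h : t < t') :
    IsProbabilityMeasure (ENNReal.ofReal (1 / (t' - t)) • volume.restrict (Ioc t t')) := by
  have : 0 < t' - t := by linarith
  constructor
  simp only [Measure.coe_smul, Pi.smul_apply, Measure.restrict_apply MeasurableSet.univ, univ_inter,
    Real.volume_Ioc, smul_eq_mul]
  rw [← ENNReal.ofReal_mul (by positivity), one_div_mul_cancel this.ne', ENNReal.ofReal_one]

lemma bind_add_left {α β : Type*} [MeasurableSpace α] [MeasurableSpace β] (m m' : Measure α)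
    (f : α → Measure β) (hf : Measurable f) : (m + m').bind f = m.bind f + m'.bind f := by
  ext s hs
  rw [Measure.bind_apply hs hf.aemeasurable, lintegral_add_measure, Measure.add_apply,
    Measure.bind_apply hs hf.aemeasurable, Measure.bind_apply hs hf.aemeasurable]

lemma zavg_mem {a b : ℕ} (G : DeltaSets a b) {t t' : ℝ} (h : t < t') (z : MControl G.DZ) :
    zavg t t' z.1 ∈ G.DZ := by
  have := isProb_unif h
  exact barycenter_mem G.DZ G.hDZprob G.hDZconv G.hDZcomp z.1 z.2.1 z.2.2 _

lemma mtraj_semigroup {a b : ℕ} (G : DeltaSets a b) {t t' : ℝ} (h0 : 0 < t) (h : t < t') (h1 : t' < 1)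
    (μ : Measure (Euc a × Euc b)) (x0 : Measure (Euc a)) (hx0 : x0 ∈ G.DX)
    (A y : MControl G.DX) (hA1 : ∀ s < t', A.1 s = x0) (hA2 : ∀ s, t' ≤ s → A.1 s = y.1 s)
    (z : MControl G.DZ) :
    mtraj t μ A.1 z.1 1 = mtraj t' (Tht t t' μ x0 (zavg t t' z.1)) y.1 z.1 1 := by
  have hxp := G.hDXprob x0 hx0
  have hzp := fun s => G.hDZprob _ (z.2.2 s)
  have hd : 0 < t' - t := by linarith
  have ht' : 0 < t' := by linarith
  have hmA := measurable_prodM A.1 z.1 A.2.1 z.2.1 (fun s => G.hDXprob _ (A.2.2 s)) hzp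
  have hza := G.hDZprob _ (zavg_mem G h z)
  have hP := isProb_unif h
  have e1 : (volume.restrict (Ioc t 1)) =
      volume.restrict (Ioc t t') + volume.restrict (Ioc t' 1) := by
    rw [← Measure.restrict_union (by
      rw [Set.disjoint_left]; rintro s ⟨_, h2⟩ ⟨h3, _⟩; linarith) measurableSet_Ioc,
      Ioc_union_Ioc_eq_Ioc h.le h1.le]
  have e2 : (volume.restrict (Ioc t t')).bind (fun s => (A.1 s).prod (z.1 s)) =
      (volume.restrict (Ioc t t')).bind (fun s => x0.prod (z.1 s)) := by
    apply Measure.bind_congr_right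
    rw [Filter.EventuallyEq, ae_restrict_iff' measurableSet_Ioc]
    filter_upwards [Measure.ae_ne volume t'] with s hs hs'
    rw [hA1 s (lt_of_le_of_ne hs'.2 hs)]
  have e3 : (volume.restrict (Ioc t' 1)).bind (fun s => (A.1 s).prod (z.1 s)) =
      (volume.restrict (Ioc t' 1)).bind (fun s => (y.1 s).prod (z.1 s)) := by
    apply Measure.bind_congr_right
    rw [Filter.EventuallyEq, ae_restrict_iff' measurableSet_Ioc]
    filter_upwards with s hs
    rw [hA2 s hs.1.le]
  have : IsProbabilityMeasure
    ((ENNReal.ofReal (1 / (t' - t)) • volume.restrict (Ioc t t')).bind z.1) := hza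
  have e4 : x0.prod (zavg t t' z.1) = ENNReal.ofReal (1 / (t' - t)) •
      (volume.restrict (Ioc t t')).bind (fun s => x0.prod (z.1 s)) := by
    rw [← Measure.bind_smul, bind_prod_const x0 z.1 z.2.1 hzp]
    rfl
  unfold mtraj Tht
  rw [e1, bind_add_left _ _ _ hmA, e2, e3, e4]
  simp only [smul_add, smul_smul, div_one, ENNReal.ofReal_one, one_mul, one_smul]
  have hq : 0 ≤ (t' - t) / t' := by positivity
  rw [← ENNReal.ofReal_mul hq, ← ENNReal.ofReal_mul ht'.le, ← ENNReal.ofReal_mul ht'.le]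
  have f1 : t' * (1 - (t' - t) / t') = t := by field_simp; ring
  have f2 : t' * ((t' - t) / t' * (1 / (t' - t))) = 1 := by field_simp
  rw [f1, f2, ENNReal.ofReal_one, one_smul, add_assoc]

lemma mtraj_decomp {a b : ℕ} (G : DeltaSets a b) {t : ℝ} (h1 : t < 1)
    (y : MControl G.DX) (z : MControl G.DZ) :
    ∃ ν : Measure (Euc a × Euc b), ν univ = ENNReal.ofReal (1 - t) ∧ ν (G.X ×ˢ G.Z)ᶜ = 0 ∧
      ∀ θ, mtraj t θ y.1 z.1 1 = ENNReal.ofReal t • θ + ν := by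
  have hxp := fun s => G.hDXprob _ (y.2.2 s)
  have hzp := fun s => G.hDZprob _ (z.2.2 s)
  have hm := measurable_prodM y.1 z.1 y.2.1 z.2.1 hxp hzp
  refine ⟨(volume.restrict (Ioc t 1)).bind (fun s => (y.1 s).prod (z.1 s)), ?_, ?_, ?_⟩
  · rw [Measure.bind_apply MeasurableSet.univ hm.aemeasurable]
    simp
  · rw [Measure.bind_apply (G.hXc.prod G.hZc).measurableSet.compl hm.aemeasurable]
    have : ∀ s, ((y.1 s).prod (z.1 s)) (G.X ×ˢ G.Z)ᶜ = 0 := fun s =>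
      G.hDsupp _ (G.hDprod _ (y.2.2 s) _ (z.2.2 s))
    simp [this]
  · intro θ
    simp [mtraj]

lemma mtraj_prob {a b : ℕ} (G : DeltaSets a b) {t : ℝ} (h0 : 0 < t) (h1 : t < 1)
    (y : MControl G.DX) (z : MControl G.DZ) (θ : Measure (Euc a × Euc b)) (hθ : θ ∈ G.D) :
    IsProbabilityMeasure (mtraj t θ y.1 z.1 1) ∧ (mtraj t θ y.1 z.1 1) (G.X ×ˢ G.Z)ᶜ = 0 := by
  obtain ⟨ν, n1, n2, n3⟩ := mtraj_decomp G h1 y z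
  have := G.hDprob θ hθ
  rw [n3]
  refine ⟨⟨?_⟩, ?_⟩
  · simp [n1]
    rw [← ENNReal.ofReal_add (by linarith) (by linarith)]
    simp
  · simp only [Measure.add_apply, Measure.smul_apply, n2, G.hDsupp θ hθ]
    simp

lemma integrable_of_lint {Ω : Type*} [MeasurableSpace Ω] [NormedAddCommGroup Ω] [BorelSpace Ω]
    [SecondCountableTopology Ω] (P : Measure (Ω × Ω)) {c : ℝ} (hc : 0 ≤ c)
    (h : ∫⁻ p, ENNReal.ofReal (‖p.1 - p.2‖ ^ 2) ∂P ≤ ENNReal.ofReal c) :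
    Integrable (fun p : Ω × Ω => ‖p.1 - p.2‖ ^ 2) P ∧ ∫ p, ‖p.1 - p.2‖ ^ 2 ∂P ≤ c := by
  have mc : Continuous (fun w : Ω × Ω => ‖w.1 - w.2‖ ^ 2) := by fun_prop
  have hn : 0 ≤ᵐ[P] (fun w : Ω × Ω => ‖w.1 - w.2‖ ^ 2) :=
    Filter.Eventually.of_forall fun w => by positivity
  refine ⟨⟨mc.aestronglyMeasurable, ?_⟩, ?_⟩
  · rw [hasFiniteIntegral_iff_ofReal hn]
    exact h.trans_lt ENNReal.ofReal_lt_top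
  · rw [integral_eq_lintegral_of_nonneg_ae hn mc.aestronglyMeasurable]
    exact ENNReal.toReal_le_of_le_ofReal hc h

lemma J_close {a b : ℕ} (G : DeltaSets a b) (Et : Set (Measure (Euc a × Euc b)))
    {t : ℝ} (h0 : 0 < t) (h1 : t < 1)
    (y : MControl G.DX) (z : MControl G.DZ) (θ θ' : Measure (Euc a × Euc b)) (hθ : θ ∈ G.D)
    (π : Measure ((Euc a × Euc b) × (Euc a × Euc b)))
    (p2 : π.map Prod.fst = θ) (p3 : π.map Prod.snd = θ') {c : ℝ} (hc : 0 ≤ c)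
    (p4 : ∫⁻ p, ENNReal.ofReal (‖p.1 - p.2‖ ^ 2) ∂π ≤ ENNReal.ofReal c) {ε : ℝ} (hε : 0 < ε) :
    W2sqSet (mtraj t θ' y.1 z.1 1) Et ≤
      (1 + ε) * W2sqSet (mtraj t θ y.1 z.1 1) Et + (1 + 1 / ε) * c := by
  have hp := (mtraj_prob G h0 h1 y z θ hθ).1
  obtain ⟨ν, n1, n2, n3⟩ := mtraj_decomp G h1 y z
  rw [n3] at hp
  rw [n3, n3]
  have mdiag : Measurable (fun w : Euc a × Euc b => (w, w)) := by fun_prop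
  set Q := ENNReal.ofReal t • π + ν.map (fun w => (w, w)) with hQ
  have q1 : Q.map Prod.fst = ENNReal.ofReal t • θ + ν := by
    rw [hQ, Measure.map_add _ _ measurable_fst, Measure.map_smul, p2,
      Measure.map_map measurable_fst mdiag]
    congr 1
    exact Measure.map_id
  have q2 : Q.map Prod.snd = ENNReal.ofReal t • θ' + ν := by
    rw [hQ, Measure.map_add _ _ measurable_snd, Measure.map_smul, p3,
      Measure.map_map measurable_snd mdiag]
    congr 1
    exact Measure.map_id
  have hQp : IsProbabilityMeasure Q := by
    constructor
    have := hp.measure_univ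
    rwa [← q1, Measure.map_apply measurable_fst MeasurableSet.univ] at this
  have hQc : ∫⁻ p, ENNReal.ofReal (‖p.1 - p.2‖ ^ 2) ∂Q ≤ ENNReal.ofReal c := by
    rw [hQ, lintegral_add_measure, lintegral_smul_measure, lintegral_map (by fun_prop) mdiag]
    simp only [sub_self, norm_zero, smul_eq_mul]
    simp only [ne_eq, OfNat.ofNat_ne_zero, not_false_eq_true, zero_pow, ENNReal.ofReal_zero,
      lintegral_zero, add_zero]
    calc _ ≤ 1 * ENNReal.ofReal c := by
          gcongr
          rw [← ENNReal.ofReal_one]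
          exact ENNReal.ofReal_le_ofReal h1.le
      _ = _ := one_mul _
  obtain ⟨i1, i2⟩ := integrable_of_lint Q hc hQc
  refine (W2sqSet_le_glue Et Q q1 q2 hε i1).trans ?_
  gcongr

lemma W2sqSet_bdd {a b : ℕ} (G : DeltaSets a b) (Et : Set (Measure (Euc a × Euc b)))
    (m0 : Measure (Euc a × Euc b)) (hm0 : m0 ∈ G.D) :
    ∃ B : ℝ, 0 ≤ B ∧ ∀ m : Measure (Euc a × Euc b), IsProbabilityMeasure m → m (G.X ×ˢ G.Z)ᶜ = 0 →
      W2sqSet m Et ≤ B := by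
  obtain ⟨R, hR⟩ := (G.hXc.prod G.hZc).isBounded.exists_norm_le
  have hp0 := G.hDprob m0 hm0
  have hn := W2sqSet_nonneg m0 Et
  refine ⟨(1 + 1) * W2sqSet m0 Et + (1 + 1 / 1) * (2 * R) ^ 2, by positivity, ?_⟩
  intro m hm hmK
  have hc : ∫⁻ p, ENNReal.ofReal (‖p.1 - p.2‖ ^ 2) ∂(m0.prod m) ≤ ENNReal.ofReal ((2 * R) ^ 2) := by
    refine lint_prod_le m0 m (by simp) (by simp) (G.X ×ˢ G.Z) (G.X ×ˢ G.Z) ?_ ?_ _ (by fun_prop) _ ?_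
    · rw [ae_iff]; exact G.hDsupp m0 hm0
    · rw [ae_iff]; exact hmK
    · intro x hx y hy
      apply ENNReal.ofReal_le_ofReal
      have : ‖x - y‖ ≤ 2 * R := by
        have := norm_sub_le x y
        linarith [hR x hx, hR y hy]
      show ‖x - y‖ ^ 2 ≤ _
      gcongr
  obtain ⟨i1, i2⟩ := integrable_of_lint _ (by positivity) hc
  refine (W2sqSet_le_glue (m := m0) (m' := m) Et (m0.prod m) (Measure.map_fst_prod.trans (by simp))
    (Measure.map_snd_prod.trans (by simp)) one_pos i1).trans ?_
  gcongr

/-- NADC with a given `N` -/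
def NADCw {Ω₁ Ω₂ : Type*} [MeasurableSpace Ω₁] [MeasurableSpace Ω₂]
    {DZ : Set (Measure Ω₂)} {DX : Set (Measure Ω₁)}
    (s0 : ℝ) (α : MControl DZ → MControl DX) (N : ℕ) : Prop :=
    (∀ z : MControl DZ, ∀ k < N, ∃ c,
      ∀ s ∈ Ico ((k : ℝ) / N) ((k + 1 : ℝ) / N), (α z).1 s = c) ∧
    (∀ k < N, ∀ z z' : MControl DZ, AEEqOn s0 ((k : ℝ) / N) z.1 z'.1 →
      AEEqOn s0 ((k + 1 : ℝ) / N) (α z).1 (α z').1)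

lemma AEEqOn.mono' {E : Type*} {s s' t t' : ℝ} {x y : ℝ → E} (h : AEEqOn s t x y)
    (hs : s ≤ s') (ht : t' ≤ t) : AEEqOn s' t' x y :=
  ae_restrict_of_ae_restrict_of_subset (Icc_subset_Icc hs ht) h

lemma NADCw.refine {Ω₁ Ω₂ : Type*} [MeasurableSpace Ω₁] [MeasurableSpace Ω₂]
    {DZ : Set (Measure Ω₂)} {DX : Set (Measure Ω₁)}
    {s0 : ℝ} {α : MControl DZ → MControl DX} {N Q : ℕ} (hN : 0 < N) (hQ : 0 < Q)
    (h : NADCw s0 α N) : NADCw s0 α (N * Q) := by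
  have hNr : (0 : ℝ) < N := by exact_mod_cast hN
  have hQr : (0 : ℝ) < Q := by exact_mod_cast hQ
  have key : ∀ k < N * Q, k / Q < N ∧ ((k / Q : ℕ) : ℝ) / N ≤ (k : ℝ) / ((N * Q : ℕ) : ℝ) ∧
      (k + 1 : ℝ) / ((N * Q : ℕ) : ℝ) ≤ (((k / Q : ℕ) : ℝ) + 1) / N := by
    intro k hk
    refine ⟨Nat.div_lt_of_lt_mul (by rwa [mul_comm]), ?_, ?_⟩
    · rw [div_le_div_iff₀ hNr (by push_cast; positivity)]
      have : k / Q * Q ≤ k := Nat.div_mul_le_self k Q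
      have : ((k / Q : ℕ) : ℝ) * Q ≤ k := by exact_mod_cast this
      push_cast
      nlinarith
    · rw [div_le_div_iff₀ (by push_cast; positivity) hNr]
      have : k + 1 ≤ (k / Q + 1) * Q := by
        have := Nat.lt_div_mul_add hQ (a := k)
        rw [add_mul, one_mul]; omega
      have : (k + 1 : ℝ) ≤ (((k / Q : ℕ) : ℝ) + 1) * Q := by exact_mod_cast this
      push_cast
      nlinarith
  refine ⟨fun z k hk => ?_, fun k hk z z' hz => ?_⟩
  · obtain ⟨k1, k2, k3⟩ := key k hk
    obtain ⟨c, hc⟩ := h.1 z _ k1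
    exact ⟨c, fun s hs => hc s ⟨k2.trans hs.1, hs.2.trans_le k3⟩⟩
  · obtain ⟨k1, k2, k3⟩ := key k hk
    exact (h.2 _ k1 z z' (hz.mono' le_rfl k2)).mono' le_rfl k3

instance {a b : ℕ} (G : DeltaSets a b) : Nonempty (MControl G.DX) :=
  ⟨⟨fun _ => G.hDXne.some, measurable_const, fun _ => G.hDXne.some_mem⟩⟩

instance {a b : ℕ} (G : DeltaSets a b) : Nonempty (MControl G.DZ) :=
  ⟨⟨fun _ => G.hDZne.some, measurable_const, fun _ => G.hDZne.some_mem⟩⟩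

lemma nadc_nonempty {a b : ℕ} (G : DeltaSets a b) (s0 : ℝ) :
    Nonempty {α : MControl G.DZ → MControl G.DX // IsNADCM s0 α} := by
  refine ⟨⟨fun _ => ⟨fun _ => G.hDXne.some, measurable_const, fun _ => G.hDXne.some_mem⟩, 1, one_pos,
    fun z k hk => ⟨_, fun s hs => rfl⟩, fun k hk z z' h => ?_⟩⟩
  exact Filter.Eventually.of_forall fun _ => rfl

lemma Tht_mem {a b : ℕ} (G : DeltaSets a b) {t t' : ℝ} (h0 : 0 < t) (h : t < t')
    (μ : Measure (Euc a × Euc b)) (hμ : μ ∈ G.D) (x0 : Measure (Euc a)) (hx0 : x0 ∈ G.DX)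
    (ζ : Measure (Euc b)) (hζ : ζ ∈ G.DZ) : Tht t t' μ x0 ζ ∈ G.D := by
  have ht' : 0 < t' := h0.trans h
  have h1 : (t' - t) / t' ≤ 1 := by rw [div_le_one ht']; linarith
  have h2 : 0 ≤ (t' - t) / t' := div_nonneg (by linarith) ht'.le
  have := G.hDconv μ hμ _ (G.hDprod x0 hx0 ζ hζ) (1 - (t' - t) / t') ⟨by linarith, by linarith⟩
  rwa [sub_sub_cancel] at this

/-- concatenation of controls -/
def concat {a b : ℕ} {G : DeltaSets a b} (t' : ℝ) (x0 : Measure (Euc a)) (hx0 : x0 ∈ G.DX)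
    (y : MControl G.DX) : MControl G.DX :=
  ⟨fun s => if s < t' then x0 else y.1 s,
    Measurable.ite (measurableSet_lt measurable_id measurable_const) measurable_const y.2.1,
    fun s => by dsimp only; split_ifs; exacts [hx0, y.2.2 s]⟩

lemma dpp {a b : ℕ} (G : DeltaSets a b) (Et : Set (Measure (Euc a × Euc b)))
    {t t' : ℝ} (h0 : 0 < t) (h : t < t') (h1 : t' < 1) (k0 N0 : ℕ) (hN0 : 0 < N0)
    (hk : t' = (k0 : ℝ) / N0)
    (μ : Measure (Euc a × Euc b)) (hμ : μ ∈ G.D) (x0 : Measure (Euc a)) (hx0 : x0 ∈ G.DX)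
    (C : ℝ) (hC : ∀ ζ ∈ G.DZ, WVplus G.DX G.DZ Et t' (Tht t t' μ x0 ζ) ≤ C) (η : ℝ) (hη : 0 < η) :
    WVplus G.DX G.DZ Et t μ ≤ C + 2 * η := by
  have ht' : 0 < t' := h0.trans h
  obtain ⟨B, hB0, hB⟩ := W2sqSet_bdd G Et μ hμ
  have hJB : ∀ {s : ℝ} (_ : 0 < s) (_ : s < 1) (y : MControl G.DX) (z : MControl G.DZ)
      (θ : Measure (Euc a × Euc b)) (_ : θ ∈ G.D), W2sqSet (mtraj s θ y.1 z.1 1) Et ≤ B := by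
    intro s hs hs1 y z θ hθ
    obtain ⟨q1, q2⟩ := mtraj_prob G hs hs1 y z θ hθ
    exact hB _ q1 q2
  have hT : ∀ ζ ∈ G.DZ, Tht t t' μ x0 ζ ∈ G.D := fun ζ hζ => Tht_mem G h0 h μ hμ x0 hx0 ζ hζ
  -- near optimal strategies
  have hopt : ∀ ζ : G.DZ, ∃ α : MControl G.DZ → MControl G.DX, ∃ N : ℕ, 0 < N ∧ NADCw t' α N ∧
      ∀ z, W2sqSet (mtraj t' (Tht t t' μ x0 ζ.1) (α z).1 z.1 1) Et ≤ C + η := by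
    intro ζ
    have := nadc_nonempty G t'
    have hlt : WVplus G.DX G.DZ Et t' (Tht t t' μ x0 ζ.1) < C + η := by
      linarith [hC ζ.1 ζ.2]
    obtain ⟨⟨α, N, hN, hα1, hα2⟩, hα⟩ := exists_lt_of_ciInf_lt hlt
    refine ⟨α, N, hN, ⟨hα1, hα2⟩, fun z => ?_⟩
    refine le_trans (le_ciSup (f := fun z : MControl G.DZ =>
      W2sqSet (mtraj t' (Tht t t' μ x0 ζ.1) (α z).1 z.1 1) Et) ?_ z) hα.le
    refine ⟨B, ?_⟩
    rintro _ ⟨z, rfl⟩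
    exact hJB ht' h1 _ _ _ (hT _ ζ.2)
  choose al Nf hNf hal hval using hopt
  -- constants
  set ε : ℝ := η / (2 * (B + 1)) with hε
  have hεp : 0 < ε := by positivity
  have hεB : ε * B ≤ η / 2 := by
    rw [hε, div_mul_eq_mul_div, div_le_div_iff₀ (by positivity) (by positivity)]
    nlinarith
  set c : ℝ := η / (2 * (1 + 1 / ε)) with hc
  have hcp : 0 < c := by positivity
  have hcc : (1 + 1 / ε) * c = η / 2 := by
    rw [hc]; field_simp
  obtain ⟨I, hI, cl, hcl⟩ := exists_class (G.hXc.prod G.hZc) hcp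
  have := Fintype.ofFinite I
  classical
  -- representatives
  have hrep : ∀ i : I, ∃ ζ : G.DZ, (∃ ζ' : G.DZ, cl (Tht t t' μ x0 ζ'.1) = i) →
      cl (Tht t t' μ x0 ζ.1) = i := by
    intro i
    by_cases hi : ∃ ζ' : G.DZ, cl (Tht t t' μ x0 ζ'.1) = i
    · obtain ⟨ζ, hζ⟩ := hi
      exact ⟨ζ, fun _ => hζ⟩
    · exact ⟨⟨_, G.hDZne.some_mem⟩, fun hh => absurd hh hi⟩
  choose rep hrep using hrep
  let ix : MControl G.DZ → I := fun z => cl (Tht t t' μ x0 (zavg t t' z.1))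
  have hix : ∀ z, cl (Tht t t' μ x0 (rep (ix z)).1) = ix z := fun z =>
    hrep _ ⟨⟨_, zavg_mem G h z⟩, rfl⟩
  let A : MControl G.DZ → MControl G.DX := fun z => concat t' x0 hx0 (al (rep (ix z)) z)
  set P : ℕ := ∏ i : I, Nf (rep i) with hP
  have hPp : 0 < P := Finset.prod_pos fun i _ => hNf _
  set N : ℕ := N0 * P with hN
  have hNp : 0 < N := Nat.mul_pos hN0 hPp
  have hNr : (0 : ℝ) < N := by exact_mod_cast hNp
  have hNref : ∀ i : I, NADCw t' (al (rep i)) N := by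
    intro i
    obtain ⟨Q, hQ⟩ : Nf (rep i) ∣ N :=
      (Finset.dvd_prod_of_mem (fun i => Nf (rep i)) (Finset.mem_univ i)).trans (Dvd.intro_left _ rfl)
    rw [hQ]
    refine (hal (rep i)).refine (hNf _) (Nat.pos_of_ne_zero ?_)
    rintro rfl
    simp at hQ
    omega
  have hkN : t' = ((k0 * P : ℕ) : ℝ) / N := by
    have : (0 : ℝ) < P := by exact_mod_cast hPp
    have : (0 : ℝ) < N0 := by exact_mod_cast hN0
    rw [hk, hN]; push_cast; field_simp
  have hstep : ∀ k : ℕ, (k : ℝ) / N < t' → ((k : ℝ) + 1) / N ≤ t' := by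
    intro k hkk
    rw [hkN] at hkk ⊢
    have : (k : ℝ) < (k0 * P : ℕ) := by rwa [div_lt_div_iff_of_pos_right hNr] at hkk
    have : k + 1 ≤ k0 * P := by exact_mod_cast this
    have : (k : ℝ) + 1 ≤ (k0 * P : ℕ) := by exact_mod_cast this
    gcongr
  have hAlt : ∀ z s, s < t' → (A z).1 s = x0 := fun z s hs => if_pos hs
  have hAge : ∀ z s, t' ≤ s → (A z).1 s = (al (rep (ix z)) z).1 s := fun z s hs =>
    if_neg (not_lt.mpr hs)
  have hAN : IsNADCM t A := by
    refine ⟨N, hNp, fun z k hkk => ?_, fun k hkk z z' hz => ?_⟩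
    · rcases lt_or_ge ((k : ℝ) / N) t' with hlt | hge
      · exact ⟨x0, fun s hs => hAlt _ _ (hs.2.trans_le (hstep k hlt))⟩
      · obtain ⟨c, hc⟩ := (hNref (ix z)).1 z k hkk
        exact ⟨c, fun s hs => (hAge _ _ (hge.trans hs.1)).trans (hc s hs)⟩
    · unfold AEEqOn
      rw [ae_restrict_iff' measurableSet_Icc]
      rcases lt_or_ge ((k : ℝ) / N) t' with hlt | hge
      · filter_upwards [Measure.ae_ne volume t'] with s hs hs'
        have : s < t' := lt_of_le_of_ne (hs'.2.trans (hstep k hlt)) hs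
        rw [hAlt _ _ this, hAlt _ _ this]
      · have hixx : ix z = ix z' := by
          have : zavg t t' z.1 = zavg t t' z'.1 := by
            unfold zavg
            apply Measure.bind_congr_right
            apply Measure.ae_smul_measure
            exact ae_restrict_of_ae_restrict_of_subset
              (Ioc_subset_Icc_self.trans (Icc_subset_Icc le_rfl hge)) hz
          show cl _ = cl _
          rw [this]
        have := (hNref (ix z)).2 k hkk z z' (hz.mono' h.le le_rfl)
        unfold AEEqOn at this
        rw [ae_restrict_iff' measurableSet_Icc] at this
        filter_upwards [this] with s hs hs'
        rcases lt_or_ge s t' with hst | hst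
        · rw [hAlt _ _ hst, hAlt _ _ hst]
        · rw [hAge _ _ hst, hAge _ _ hst, ← hixx]
          exact hs ⟨hst, hs'.2⟩
  have hfin : (⨆ z : MControl G.DZ, W2sqSet (mtraj t μ (A z).1 z.1 1) Et) ≤ C + 2 * η := by
    refine ciSup_le fun z => ?_
    rw [mtraj_semigroup G h0 h h1 μ x0 hx0 (A z) (al (rep (ix z)) z) (hAlt z) (hAge z) z]
    have d1 := hT _ (rep (ix z)).2
    have d2 := hT _ (zavg_mem G h z)
    obtain ⟨π, -, p2, p3, p4⟩ := hcl _ _ (G.hDprob _ d1) (G.hDprob _ d2) (G.hDsupp _ d1)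
      (G.hDsupp _ d2) (hix z)
    refine (J_close G Et ht' h1 _ z _ _ d1 π p2 p3 hcp.le p4 hεp).trans ?_
    have v1 := hval (rep (ix z)) z
    have v2 := hJB ht' h1 (al (rep (ix z)) z) z _ d1
    rw [hcc]
    nlinarith [mul_le_mul_of_nonneg_left v2 hεp.le]
  refine (ciInf_le (f := fun α : {α : MControl G.DZ → MControl G.DX // IsNADCM t α} =>
    ⨆ z : MControl G.DZ, W2sqSet (mtraj t μ (α.1 z).1 z.1 1) Et) ?_ ⟨A, hAN⟩).trans hfin
  refine ⟨0, ?_⟩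
  rintro _ ⟨α, rfl⟩
  exact Real.iSup_nonneg fun z => W2sqSet_nonneg _ _

lemma int_bound {a b : ℕ} (G : DeltaSets a b) (φ : Euc a × Euc b → ℝ)
    (hφ : ContinuousOn φ (G.X ×ˢ G.Z)) : ∃ M, ∀ θ ∈ G.D, ∫ p, φ p ∂θ ≤ M := by
  obtain ⟨M, hM⟩ := (G.hXc.prod G.hZc).exists_bound_of_continuousOn hφ
  refine ⟨M, fun θ hθ => ?_⟩
  have := G.hDprob θ hθ
  have h := norm_integral_le_of_norm_le_const (μ := θ) (f := φ) (C := M) (by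
    have : ∀ᵐ p ∂θ, p ∈ G.X ×ˢ G.Z := by rw [ae_iff]; exact G.hDsupp θ hθ
    filter_upwards [this] with p hp using hM p hp)
  simp at h
  exact (abs_le.mp h).2

/-- The upper value `V⁺` of the game `Γ_{Ẽ,δ}` is a sub-solution of the
Hamilton–Jacobi equation `ω_t + ℋ⁺(t,μ,Dω) = 0` on `(s0,1) × Δ_δ(X×Z)`: for every `(t,μ)`
and every `(p,φ) ∈ D⁺V⁺(t,μ)` one has `p + ℋ⁺(t,μ,φ) ≥ 0`. -/
theorem statement11 {a b : ℕ} (G : DeltaSets a b)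
    (pstar : Euc a × Euc b) (hpstar : pstar ∈ G.X ×ˢ G.Z)
    (Et : Set (Measure (Euc a × Euc b)))
    (hEt : IsClosed {q : ProbabilityMeasure (Euc a × Euc b) | (q : Measure (Euc a × Euc b)) ∈ Et})
    (s0 : ℝ) (hs0 : s0 ∈ Ioo (0 : ℝ) 1) :
    ∀ t ∈ Ioo s0 1, ∀ μ ∈ G.D, ∀ p : ℝ, ∀ φ ∈ Xi (G.X ×ˢ G.Z) pstar,
      InSuperDiff s0 G.D (WVplus G.DX G.DZ Et) t μ p φ →
      0 ≤ p + Hplus G.DX G.DZ t μ φ := by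
  intro t ht μ hμ p φ hφ hsd
  have ht0 : 0 < t := hs0.1.trans ht.1
  have : Nonempty G.DX := G.hDXne.to_subtype
  have hne : Nonempty G.DZ := G.hDZne.to_subtype
  suffices hs : -p ≤ Hplus G.DX G.DZ t μ φ by linarith
  refine le_ciInf fun x => ?_
  obtain ⟨M, hM⟩ := int_bound G φ hφ.1
  set S : ℝ := ⨆ z : G.DZ, (1 / t) * ((∫ p, φ p ∂(x.1.prod z.1)) - ∫ p, φ p ∂μ) with hS
  have hSz : ∀ ζ ∈ G.DZ, (∫ p, φ p ∂(x.1.prod ζ)) - ∫ p, φ p ∂μ ≤ t * S := by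
    intro ζ hζ
    have := le_ciSup (f := fun z : G.DZ => (1 / t) * ((∫ p, φ p ∂(x.1.prod z.1)) - ∫ p, φ p ∂μ))
      ⟨(1 / t) * (M - ∫ p, φ p ∂μ), by
        rintro _ ⟨z, rfl⟩
        have := hM _ (G.hDprod _ x.2 _ z.2)
        dsimp only
        gcongr⟩ ⟨ζ, hζ⟩
    rw [← hS] at this
    dsimp only at this
    rw [one_div, inv_mul_le_iff₀ ht0] at this
    exact this
  by_contra hcon
  push Not at hcon
  set κ : ℝ := -p - S with hκ
  have hκp : 0 < κ := by linarith
  -- superdifferential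
  obtain ⟨r, hr, hsd⟩ := hsd (κ / 4 / (1 / t + 1)) (by positivity)
  set d : ℝ := min (min (r * t) r) (min (1 - t) (t * κ / (4 * (|S| + 1)))) with hd
  have hdp : 0 < d := by
    have : 0 < 1 - t := by linarith [ht.2]
    have : 0 < |S| + 1 := by positivity
    refine lt_min (lt_min ?_ ?_) (lt_min ?_ ?_) <;> positivity
  obtain ⟨q, hq1, hq2⟩ := exists_rat_btwn (show t < t + d by linarith)
  set t' : ℝ := (q : ℝ) with ht'
  have hh : 0 < t' - t := by linarith
  have hhd : t' - t < d := by linarith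
  have a1 : t' - t < r * t := hhd.trans_le ((min_le_left _ _).trans (min_le_left _ _))
  have a2 : t' - t < r := hhd.trans_le ((min_le_left _ _).trans (min_le_right _ _))
  have a3 : t' - t < 1 - t := hhd.trans_le ((min_le_right _ _).trans (min_le_left _ _))
  have a4 : t' - t < t * κ / (4 * (|S| + 1)) :=
    hhd.trans_le ((min_le_right _ _).trans (min_le_right _ _))
  have ht'0 : 0 < t' := by linarith
  have hqpos : 0 < q := Rat.cast_pos.mp ht'0
  have hq : t' = ((q.num.toNat : ℕ) : ℝ) / ((q.den : ℕ) : ℝ) := by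
    have h1 : ((q.num.toNat : ℕ) : ℤ) = q.num := Int.toNat_of_nonneg (Rat.num_nonneg.mpr hqpos.le)
    have h2 : ((q.num.toNat : ℕ) : ℝ) = (q.num : ℝ) := by exact_mod_cast congrArg (Int.cast (R := ℝ)) h1
    rw [h2, ht', Rat.cast_def]
  have hal0 : 0 < (t' - t) / t' := by positivity
  have halt : (t' - t) / t' ≤ (t' - t) / t := by gcongr
  have halr : (t' - t) / t' < r := by
    refine halt.trans_lt ?_
    rwa [div_lt_iff₀ ht0]
  have hC : ∀ ζ ∈ G.DZ, WVplus G.DX G.DZ Et t' (Tht t t' μ x.1 ζ) ≤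
      WVplus G.DX G.DZ Et t μ - (t' - t) * (κ / 2) := by
    intro ζ hζ
    have h1 := hsd ((t' - t) / t') ⟨hal0, halr⟩ t' ⟨by linarith [ht.1], by linarith⟩
      (by rw [abs_of_pos hh]; exact a2) _ (G.hDprod _ x.2 _ hζ)
    change WVplus G.DX G.DZ Et t' (Tht t t' μ x.1 ζ) - _ - _ - _ ≤ _ at h1
    rw [abs_of_pos hh] at h1
    have h2 := mul_le_mul_of_nonneg_left (hSz ζ hζ) hal0.le
    have h3 : κ / 4 / (1 / t + 1) * ((t' - t) / t' + (t' - t)) ≤ (t' - t) * (κ / 4) := by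
      calc _ ≤ κ / 4 / (1 / t + 1) * ((t' - t) / t + (t' - t)) := by gcongr
        _ = _ := by field_simp
    have h4 : (t' - t) / t' * (t * S) ≤ (t' - t) * S + (t' - t) * (κ / 4) := by
      have e : (t' - t) / t' * (t * S) = (t' - t) * S + (t' - t) * (((t' - t) / t') * (-S)) := by
        field_simp; ring
      rw [e]
      have : ((t' - t) / t') * (-S) ≤ κ / 4 := by
        calc ((t' - t) / t') * (-S) ≤ ((t' - t) / t') * (|S| + 1) := by
              gcongr; linarith [neg_abs_le S]
          _ ≤ ((t' - t) / t) * (|S| + 1) := by gcongr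
          _ ≤ (t * κ / (4 * (|S| + 1))) / t * (|S| + 1) := by gcongr
          _ = κ / 4 := by field_simp
      gcongr
    have h5 : p * (t' - t) + (t' - t) * S = - ((t' - t) * κ) := by rw [hκ]; ring
    linarith
  have := dpp G Et ht0 (by linarith : t < t') (by linarith) _ _ q.den_pos hq μ hμ x.1 x.2 _ hC
    ((t' - t) * (κ / 8)) (by positivity)
  have : 0 < (t' - t) * κ := by positivity
  linarith
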